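/- Let w be a weight on ℝⁿ (nonnegative, locally integrable) and suppose Buckley's estimate ‖Mf‖_{L^p(w)} ≤ c(p,n) ‖w‖_{A_p}^{1/(p−1)} ‖f‖_{L^p(w)} holds for the Hardy–Littlewood maximal operator M and some fixed p > 1. Then ‖w‖_{A_∞} ≤ c(p,n) ‖w‖_{A_p}, where ‖w‖_{A_∞} = sup_Q (1/w(Q)) ∫_Q M(wχ_Q)(x) dx. -/

import Mathlib

open MeasureTheory

/-- An open axis-parallel cube in `ℝⁿ` with lower corner `a` and side length `h`. -/
def cube {n : ℕ} (a : Fin n → ℝ) (h : ℝ) : Set (Fin n → ℝ) :=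
  {x | ∀ i, x i ∈ Set.Ioo (a i) (a i + h)}

/-- The set of values `(|Q|⁻¹∫_Q w)(|Q|⁻¹∫_Q w^{-1/(p-1)})^{p-1}` over all cubes `Q`. -/
def ApSet (n : ℕ) (p : ℝ) (w : (Fin n → ℝ) → ℝ) : Set ℝ :=
  {r | ∃ (a : Fin n → ℝ) (h : ℝ), 0 < h ∧
    r = (((volume (cube a h)).toReal)⁻¹ * ∫ x in cube a h, w x) *
      (((volume (cube a h)).toReal)⁻¹ * ∫ x in cube a h, w x ^ (-(1 / (p - 1)))) ^ (p - 1)}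

/-- The `A_p` characteristic `‖w‖_{A_p}`. -/
noncomputable def ApNorm (n : ℕ) (p : ℝ) (w : (Fin n → ℝ) → ℝ) : ℝ :=
  sSup (ApSet n p w)

/-- The Hardy–Littlewood maximal operator `Mf(x) = sup_{Q ∋ x} |Q|⁻¹ ∫_Q |f|`. -/
noncomputable def maxOp (n : ℕ) (f : (Fin n → ℝ) → ℝ) (x : Fin n → ℝ) : ℝ :=
  sSup {r | ∃ (a : Fin n → ℝ) (h : ℝ), 0 < h ∧ x ∈ cube a h ∧
    r = ((volume (cube a h)).toReal)⁻¹ * ∫ y in cube a h, |f y|}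

/-- The `A_∞` characteristic `‖w‖_{A_∞} = sup_Q (1/w(Q)) ∫_Q M(wχ_Q)`. -/
noncomputable def AinfNorm (n : ℕ) (w : (Fin n → ℝ) → ℝ) : ℝ :=
  sSup {r | ∃ (a : Fin n → ℝ) (h : ℝ), 0 < h ∧
    r = (∫ x in cube a h, w x)⁻¹ * ∫ x in cube a h, maxOp n ((cube a h).indicator w) x}

/-- The measure `w dx`. -/
noncomputable def wMeasure (n : ℕ) (w : (Fin n → ℝ) → ℝ) : Measure (Fin n → ℝ) :=
  volume.withDensity fun x => ENNReal.ofReal (w x)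


open scoped ENNReal

lemma cube_eq_pi {n : ℕ} (b : Fin n → ℝ) (r : ℝ) :
    cube b r = Set.pi Set.univ (fun i => Set.Ioo (b i) (b i + r)) := by
  ext x; simp [cube]

lemma measurableSet_cube {n : ℕ} (b : Fin n → ℝ) (r : ℝ) : MeasurableSet (cube b r) := by
  rw [cube_eq_pi]; exact MeasurableSet.univ_pi (fun i => measurableSet_Ioo)

lemma volume_cube {n : ℕ} (b : Fin n → ℝ) (r : ℝ) :
    volume (cube b r) = ENNReal.ofReal r ^ n := by
  rw [cube_eq_pi, volume_pi_pi]; simp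

lemma volume_cube_ne_zero {n : ℕ} (b : Fin n → ℝ) {r : ℝ} (hr : 0 < r) :
    volume (cube b r) ≠ 0 := by
  rw [volume_cube]; simp [hr]

lemma volume_cube_ne_top {n : ℕ} (b : Fin n → ℝ) (r : ℝ) :
    volume (cube b r) ≠ ⊤ := by
  rw [volume_cube]; simp

lemma integrableOn_cube {n : ℕ} {w : (Fin n → ℝ) → ℝ} (hw : LocallyIntegrable w volume)
    (b : Fin n → ℝ) (r : ℝ) : IntegrableOn w (cube b r) volume := by
  have : IntegrableOn w (Set.Icc b (fun i => b i + r)) volume :=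
    hw.integrableOn_isCompact isCompact_Icc
  refine this.mono_set ?_
  intro x hx
  exact ⟨fun i => (hx i).1.le, fun i => (hx i).2.le⟩

lemma wMeasure_apply {n : ℕ} (w : (Fin n → ℝ) → ℝ) {E : Set (Fin n → ℝ)}
    (hE : MeasurableSet E) : wMeasure n w E = ∫⁻ x in E, ENNReal.ofReal (w x) := by
  rw [wMeasure, withDensity_apply _ hE]

lemma wMeasure_cube_ne_top {n : ℕ} {w : (Fin n → ℝ) → ℝ}
    (hw : LocallyIntegrable w volume)
    (b : Fin n → ℝ) (r : ℝ) : wMeasure n w (cube b r) ≠ ⊤ := by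
  rw [wMeasure_apply _ (measurableSet_cube b r)]
  exact (integrableOn_cube hw b r).lintegral_lt_top.ne

lemma integral_cube {n : ℕ} {w : (Fin n → ℝ) → ℝ} (h0 : ∀ x, 0 ≤ w x) (hm : Measurable w)
    (b : Fin n → ℝ) (r : ℝ) :
    ∫ x in cube b r, w x = (wMeasure n w (cube b r)).toReal := by
  rw [wMeasure_apply _ (measurableSet_cube b r), integral_eq_lintegral_of_nonneg_ae]
  · exact Filter.Eventually.of_forall h0
  · exact hm.aestronglyMeasurable

/-- Testing Buckley's estimate. -/
lemma buckley_test {n : ℕ} {p : ℝ} (hp : 1 < p) {w : (Fin n → ℝ) → ℝ}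
    (h0 : ∀ x, 0 ≤ w x) (hm : Measurable w) (K : ℝ≥0∞)
    (hB : ∀ f : (Fin n → ℝ) → ℝ, Measurable f →
        eLpNorm (maxOp n f) (ENNReal.ofReal p) (wMeasure n w) ≤
          K * eLpNorm f (ENNReal.ofReal p) (wMeasure n w))
    (b : Fin n → ℝ) {r : ℝ} (hr : 0 < r) {ε : ℝ} (hε : 0 < ε) :
    (∫⁻ x in cube b r, ENNReal.ofReal (w x + ε) ^ (-(1 / (p - 1)))) ^ (p - 1)
      * wMeasure n w (cube b r) ≤ K ^ p * volume (cube b r) ^ p ∧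
    (∫⁻ x in cube b r, ENNReal.ofReal (w x + ε) ^ (-(1 / (p - 1)))) ≠ 0 := by
  set J := cube b r with hJ
  have hJm : MeasurableSet J := measurableSet_cube b r
  have hv0 : volume J ≠ 0 := volume_cube_ne_zero b hr
  have hvt : volume J ≠ ⊤ := volume_cube_ne_top b r
  set s : ℝ := 1 / (p - 1) with hs
  have hp1 : 0 < p - 1 := by linarith
  have hs0 : 0 < s := by positivity
  have hsp : s * p = 1 + s := by rw [hs]; field_simp; ring
  set g : (Fin n → ℝ) → ℝ := fun x => (w x + ε) ^ (-s) with hg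
  have hpos : ∀ x, 0 < w x + ε := fun x => by have := h0 x; linarith
  have hg0 : ∀ x, 0 < g x := fun x => Real.rpow_pos_of_pos (hpos x) _
  have hgle : ∀ x, g x ≤ ε ^ (-s) := fun x =>
    Real.rpow_le_rpow_of_nonpos hε (by linarith [h0 x]) (by linarith)
  have hgm : Measurable g := (hm.add_const ε).pow_const _
  have hGg : ∀ x, ENNReal.ofReal (w x + ε) ^ (-s) = ENNReal.ofReal (g x) := fun x => by
    rw [hg, ENNReal.ofReal_rpow_of_pos (hpos x)]
  simp_rw [hGg]
  set I := ∫⁻ x in J, ENNReal.ofReal (g x) with hI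
  have hI0 : I ≠ 0 := by
    rw [hI]
    intro h
    rw [lintegral_eq_zero_iff hgm.ennreal_ofReal] at h
    have h2 : ∀ᵐ x ∂(volume.restrict J), False := by
      filter_upwards [h] with x hx
      simp only [Pi.zero_apply, ENNReal.ofReal_eq_zero] at hx
      exact absurd (hg0 x) (not_lt.mpr hx)
    rw [Filter.eventually_false_iff_eq_bot, ae_eq_bot, Measure.restrict_eq_zero] at h2
    exact hv0 h2
  have hIt : I ≠ ⊤ := by
    have : I ≤ ∫⁻ x in J, ENNReal.ofReal (ε ^ (-s)) :=
      lintegral_mono fun x => ENNReal.ofReal_le_ofReal (hgle x)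
    refine ne_top_of_le_ne_top ?_ this
    rw [setLIntegral_const]
    exact ENNReal.mul_ne_top ENNReal.ofReal_ne_top hvt
  refine ⟨?_, hI0⟩
  set f := J.indicator g with hf
  have hfm : Measurable f := hgm.indicator hJm
  have hf0 : ∀ x, 0 ≤ f x := fun x => Set.indicator_nonneg (fun y _ => (hg0 y).le) x
  have hfle : ∀ x, f x ≤ ε ^ (-s) := fun x => by
    rw [hf]; by_cases hx : x ∈ J
    · simp [hx, hgle x]
    · simp [hx]; positivity
  -- lower bound
  have hlow : ∀ x ∈ J, I / volume J ≤ ENNReal.ofReal (maxOp n f x) := by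
    intro x hx
    have hbdd : BddAbove {r | ∃ (a : Fin n → ℝ) (h : ℝ), 0 < h ∧ x ∈ cube a h ∧
        r = ((volume (cube a h)).toReal)⁻¹ * ∫ y in cube a h, |f y|} := by
      refine ⟨ε ^ (-s), ?_⟩
      rintro _ ⟨a, h, hh, -, rfl⟩
      have hv : 0 < (volume (cube a h)).toReal :=
        ENNReal.toReal_pos (volume_cube_ne_zero a hh) (volume_cube_ne_top a h)
      rw [inv_mul_le_iff₀ hv]
      have h1 := norm_setIntegral_le_of_norm_le_const (f := fun y => |f y|) (μ := volume)
        (s := cube a h) (C := ε ^ (-s)) (lt_top_iff_ne_top.mpr (volume_cube_ne_top a h))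
        (fun y _ => by simpa [abs_of_nonneg (hf0 y)] using hfle y)
      refine (le_abs_self _).trans (h1.trans ?_)
      rw [mul_comm]; rfl
    have h1 := le_csSup hbdd ⟨b, r, hr, hx, rfl⟩
    have h2 : ∫ y in cube b r, |f y| = I.toReal := by
      rw [hI, ← hJ, ← integral_eq_lintegral_of_nonneg_ae]
      · refine setIntegral_congr_fun hJm fun y hy => ?_
        simp [hf, hy, abs_of_pos (hg0 y)]
      · exact Filter.Eventually.of_forall fun x => (hg0 x).le
      · exact hgm.aestronglyMeasurable
    rw [h2] at h1
    refine le_trans (le_of_eq ?_) (ENNReal.ofReal_le_ofReal h1)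
    rw [← hJ, ENNReal.ofReal_mul (by positivity), ENNReal.ofReal_toReal hIt,
      ENNReal.ofReal_inv_of_pos (ENNReal.toReal_pos hv0 hvt), ENNReal.ofReal_toReal hvt,
      ENNReal.div_eq_inv_mul]
  have hP0 : ENNReal.ofReal p ≠ 0 := by simp; linarith
  have hPt : ENNReal.ofReal p ≠ ⊤ := ENNReal.ofReal_ne_top
  have hPr : (ENNReal.ofReal p).toReal = p := ENNReal.toReal_ofReal (by linarith)
  have hpp : 0 < p := by linarith
  have h3 := ENNReal.rpow_le_rpow (hB f hfm) hpp.le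
  rw [ENNReal.mul_rpow_of_nonneg _ _ hpp.le,
    eLpNorm_eq_lintegral_rpow_enorm_toReal hP0 hPt,
    eLpNorm_eq_lintegral_rpow_enorm_toReal hP0 hPt, hPr, ← ENNReal.rpow_mul,
    ← ENNReal.rpow_mul, one_div, inv_mul_cancel₀ hpp.ne', ENNReal.rpow_one, ENNReal.rpow_one]
    at h3
  have h4 : (I / volume J) ^ p * wMeasure n w J ≤ ∫⁻ x, ‖maxOp n f x‖ₑ ^ p ∂(wMeasure n w) := by
    rw [← setLIntegral_const]
    refine le_trans (setLIntegral_mono' hJm fun x hx => ?_) (setLIntegral_le_lintegral J _)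
    gcongr
    refine (hlow x hx).trans ?_
    exact Real.ofReal_le_enorm _
  have h5 : ∫⁻ x, ‖f x‖ₑ ^ p ∂(wMeasure n w) ≤ I := by
    rw [wMeasure, lintegral_withDensity_eq_lintegral_mul _ hm.ennreal_ofReal
      (hfm.enorm.pow_const p), hI, ← lintegral_indicator hJm]
    refine lintegral_mono fun x => ?_
    by_cases hx : x ∈ J
    · simp only [Pi.mul_apply, hf, hx, Set.indicator_of_mem]
      rw [Real.enorm_of_nonneg (hg0 x).le, ENNReal.ofReal_rpow_of_pos (hg0 x),
        ← ENNReal.ofReal_mul (h0 x)]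
      apply ENNReal.ofReal_le_ofReal
      simp only [hg]
      rw [← Real.rpow_mul (hpos x).le]
      have : -s = 1 + -s * p := by linarith
      conv_rhs => rw [this, Real.rpow_add (hpos x), Real.rpow_one]
      exact mul_le_mul_of_nonneg_right (by linarith) (Real.rpow_nonneg (hpos x).le _)
    · simp [hf, hx, hpp]
  have h6 : (I / volume J) ^ p * wMeasure n w J ≤ K ^ p * I :=
    h4.trans (h3.trans (by gcongr))
  rw [ENNReal.div_rpow_of_nonneg _ _ hpp.le] at h6
  have hIp : I ^ p = I * I ^ (p - 1) := by
    have h := ENNReal.rpow_add 1 (p - 1) hI0 hIt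
    rwa [ENNReal.rpow_one, add_sub_cancel] at h
  have hvp0 : volume J ^ p ≠ 0 := by simp [hv0, hvt]
  have hvpt : volume J ^ p ≠ ⊤ := by simp [hv0, hvt]
  rw [hIp] at h6
  rw [← ENNReal.mul_le_mul_iff_right hI0 hIt]
  calc I * (I ^ (p - 1) * wMeasure n w J)
      = (volume J ^ p * (volume J ^ p)⁻¹) * (I * (I ^ (p - 1) * wMeasure n w J)) := by
        rw [ENNReal.mul_inv_cancel hvp0 hvpt, one_mul]
    _ = volume J ^ p * (I * I ^ (p - 1) / volume J ^ p * wMeasure n w J) := by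
        rw [ENNReal.div_eq_inv_mul]; ring
    _ ≤ volume J ^ p * (K ^ p * I) := by gcongr
    _ = I * (K ^ p * volume J ^ p) := by ring

lemma sigma_finite_of_buckley {n : ℕ} {p : ℝ} (hp : 1 < p) {w : (Fin n → ℝ) → ℝ}
    (h0 : ∀ x, 0 ≤ w x) (hm : Measurable w) (K : ℝ≥0∞) (hK : K ≠ ⊤)
    (hB : ∀ f : (Fin n → ℝ) → ℝ, Measurable f →
        eLpNorm (maxOp n f) (ENNReal.ofReal p) (wMeasure n w) ≤
          K * eLpNorm f (ENNReal.ofReal p) (wMeasure n w))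
    (b : Fin n → ℝ) {r : ℝ} (hr : 0 < r) (hJ0 : wMeasure n w (cube b r) ≠ 0) :
    K ≠ 0 ∧ (∫⁻ x in cube b r, ENNReal.ofReal (w x) ^ (-(1 / (p - 1)))) ≠ ⊤ := by
  have hp1 : 0 < p - 1 := by linarith
  have hpp : 0 < p := by linarith
  constructor
  · rintro rfl
    obtain ⟨h1, h2⟩ := buckley_test hp h0 hm 0 hB b hr one_pos
    rw [ENNReal.zero_rpow_of_pos hpp, zero_mul, nonpos_iff_eq_zero, mul_eq_zero] at h1
    rcases h1 with h1 | h1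
    · rw [ENNReal.rpow_eq_zero_iff] at h1
      rcases h1 with h1 | h1
      · exact h2 h1.1
      · linarith [h1.2]
    · exact hJ0 h1
  · set B : ℝ≥0∞ := (K ^ p * volume (cube b r) ^ p / wMeasure n w (cube b r)) ^ (1 / (p - 1))
      with hBdef
    have hBt : B ≠ ⊤ := by
      refine ENNReal.rpow_ne_top_of_nonneg (by positivity) (ENNReal.div_ne_top ?_ hJ0)
      exact ENNReal.mul_ne_top (ENNReal.rpow_ne_top_of_nonneg hpp.le hK)
        (ENNReal.rpow_ne_top_of_nonneg hpp.le (volume_cube_ne_top b r))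
    have hle : ∀ k : ℕ, (∫⁻ x in cube b r,
        ENNReal.ofReal (w x + 1 / ((k : ℝ) + 1)) ^ (-(1 / (p - 1)))) ≤ B := by
      intro k
      obtain ⟨h1, -⟩ := buckley_test hp h0 hm K hB b hr (ε := 1 / ((k : ℝ) + 1)) (by positivity)
      have h2 := ENNReal.rpow_le_rpow (ENNReal.le_div_iff_mul_le (.inl hJ0)
        (.inr (ENNReal.mul_ne_top (ENNReal.rpow_ne_top_of_nonneg hpp.le hK)
        (ENNReal.rpow_ne_top_of_nonneg hpp.le (volume_cube_ne_top b r)))) |>.mpr h1)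
        (z := 1 / (p - 1)) (by positivity)
      rwa [← ENNReal.rpow_mul, mul_one_div_cancel hp1.ne', ENNReal.rpow_one] at h2
    refine ne_top_of_le_ne_top hBt ?_
    have hlim : ∀ x, Filter.liminf (fun k : ℕ =>
        ENNReal.ofReal (w x + 1 / ((k : ℝ) + 1)) ^ (-(1 / (p - 1)))) Filter.atTop
        = ENNReal.ofReal (w x) ^ (-(1 / (p - 1))) := by
      intro x
      apply Filter.Tendsto.liminf_eq
      refine (ENNReal.continuous_rpow_const.tendsto _).comp
        ((ENNReal.continuous_ofReal.tendsto _).comp ?_)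
      simpa using tendsto_one_div_add_atTop_nhds_zero_nat.const_add (w x)
    simp_rw [← hlim]
    refine (lintegral_liminf_le fun k => ?_).trans ?_
    · exact ((hm.add_const _).ennreal_ofReal).pow_const _
    · refine Filter.liminf_le_of_le (by isBoundedDefault) ?_
      intro c hc
      obtain ⟨k, hk⟩ := hc.exists
      exact hk.trans (hle k)

/-- The quantitative `A_p` absolute continuity. -/
lemma ap_key {n : ℕ} {p : ℝ} (hp : 1 < p) {w : (Fin n → ℝ) → ℝ}
    (h0 : ∀ x, 0 ≤ w x) (hm : Measurable w) (hw : LocallyIntegrable w volume)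
    (hbdd : BddAbove (ApSet n p w))
    (b : Fin n → ℝ) {r : ℝ} (hr : 0 < r)
    (hσ : (∫⁻ x in cube b r, ENNReal.ofReal (w x) ^ (-(1 / (p - 1)))) ≠ ⊤)
    {E : Set (Fin n → ℝ)} (hE : MeasurableSet E) (hEJ : E ⊆ cube b r)
    (hv : volume (cube b r) ≤ 2 * volume E) :
    wMeasure n w (cube b r) ≤ ENNReal.ofReal (2 ^ p * ApNorm n p w) * wMeasure n w E := by
  have hp1 : 0 < p - 1 := by linarith
  have hpp : 0 < p := by linarith
  set J := cube b r with hJ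
  have hJm : MeasurableSet J := measurableSet_cube b r
  have hv0 : volume J ≠ 0 := volume_cube_ne_zero b hr
  have hvt : volume J ≠ ⊤ := volume_cube_ne_top b r
  have hμt : wMeasure n w J ≠ ⊤ := wMeasure_cube_ne_top hw b r
  have hE0 : volume E ≠ 0 := by
    intro h; rw [h, mul_zero, nonpos_iff_eq_zero] at hv; exact hv0 hv
  have hEt : volume E ≠ ⊤ := ne_top_of_le_ne_top hvt (measure_mono hEJ)
  set s : ℝ := 1 / (p - 1) with hs
  have hs0 : 0 < s := by positivity
  set SS := ∫⁻ x in J, ENNReal.ofReal (w x) ^ (-s) with hSS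
  have hWm : Measurable fun x => ENNReal.ofReal (w x) := hm.ennreal_ofReal
  have hpos : ∀ᵐ x ∂(volume.restrict J), 0 < w x := by
    filter_upwards [ae_lt_top (hWm.pow_const _) hσ] with x hx
    by_contra hne
    have : w x = 0 := le_antisymm (not_lt.mp hne) (h0 x)
    rw [this, ENNReal.ofReal_zero, ENNReal.zero_rpow_of_neg (by linarith)] at hx
    exact lt_irrefl _ hx
  have hA : wMeasure n w J * SS ^ (p - 1) ≤ ENNReal.ofReal (ApNorm n p w) * volume J ^ p := by
    have h1 : ((volume J).toReal⁻¹ * ∫ x in J, w x) *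
      ((volume J).toReal⁻¹ * ∫ x in J, w x ^ (-s)) ^ (p - 1) ≤ ApNorm n p w :=
      le_csSup hbdd ⟨b, r, hr, rfl⟩
    have h2 : ∫ x in J, w x ^ (-s) = SS.toReal := by
      rw [integral_eq_lintegral_of_nonneg_ae, hSS]
      · congr 1
        apply lintegral_congr_ae
        filter_upwards [hpos] with x hx
        rw [ENNReal.ofReal_rpow_of_pos hx]
      · exact Filter.Eventually.of_forall fun x => Real.rpow_nonneg (h0 x) _
      · exact (hm.pow_const _).aestronglyMeasurable
    rw [h2, hJ, integral_cube h0 hm, ← hJ] at h1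
    have h3 := ENNReal.ofReal_le_ofReal h1
    have hvr : 0 < (volume J).toReal := ENNReal.toReal_pos hv0 hvt
    rw [ENNReal.ofReal_mul (by positivity), ← ENNReal.ofReal_rpow_of_nonneg (by positivity) hp1.le,
      ENNReal.ofReal_mul (by positivity), ENNReal.ofReal_mul (by positivity),
      ENNReal.ofReal_inv_of_pos hvr, ENNReal.ofReal_toReal hvt, ENNReal.ofReal_toReal hμt,
      ENNReal.ofReal_toReal hσ, ENNReal.mul_rpow_of_nonneg _ _ hp1.le, ENNReal.inv_rpow] at h3
    have hvp : volume J ^ p = volume J * volume J ^ (p - 1) := by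
      have h := ENNReal.rpow_add 1 (p - 1) hv0 hvt
      rwa [ENNReal.rpow_one, add_sub_cancel] at h
    have hq0 : volume J ^ (p - 1) ≠ 0 := by simp [hv0, hvt]
    have hqt : volume J ^ (p - 1) ≠ ⊤ := ENNReal.rpow_ne_top_of_nonneg hp1.le hvt
    calc wMeasure n w J * SS ^ (p - 1) = (volume J * (volume J)⁻¹) *
          (volume J ^ (p - 1) * (volume J ^ (p - 1))⁻¹) * (wMeasure n w J * SS ^ (p - 1)) := by
          rw [ENNReal.mul_inv_cancel hv0 hvt, ENNReal.mul_inv_cancel hq0 hqt, one_mul, one_mul]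
      _ = ((volume J)⁻¹ * wMeasure n w J * ((volume J ^ (p - 1))⁻¹ * SS ^ (p - 1))) *
          volume J ^ p := by rw [hvp]; ring
      _ ≤ _ := by gcongr
  have hH : volume E ^ p ≤ wMeasure n w E * SS ^ (p - 1) := by
    have hpq : p.HolderConjugate (p / (p - 1)) := Real.HolderConjugate.conjExponent hp
    have h1 := ENNReal.lintegral_mul_le_Lp_mul_Lq (volume.restrict E) hpq
      (f := fun x => ENNReal.ofReal (w x) ^ (1 / p))
      (g := fun x => ENNReal.ofReal (w x) ^ (-(1 / p)))
      (hWm.pow_const _).aemeasurable (hWm.pow_const _).aemeasurable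
    have h2 : ∫⁻ x in E, ((fun x => ENNReal.ofReal (w x) ^ (1 / p)) *
        (fun x => ENNReal.ofReal (w x) ^ (-(1 / p)))) x = volume E := by
      rw [← setLIntegral_one]
      apply lintegral_congr_ae
      filter_upwards [ae_restrict_of_ae_restrict_of_subset hEJ hpos] with x hx
      simp only [Pi.mul_apply]
      rw [← ENNReal.rpow_add _ _ (by simpa using hx) ENNReal.ofReal_ne_top, add_neg_cancel,
        ENNReal.rpow_zero]
    rw [h2] at h1
    have e1 : ∀ x, (ENNReal.ofReal (w x) ^ (1 / p)) ^ p = ENNReal.ofReal (w x) := fun x => by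
      rw [← ENNReal.rpow_mul, one_div_mul_cancel hpp.ne', ENNReal.rpow_one]
    have e2 : ∀ x, (ENNReal.ofReal (w x) ^ (-(1 / p))) ^ (p / (p - 1)) =
        ENNReal.ofReal (w x) ^ (-s) := fun x => by
      rw [← ENNReal.rpow_mul]; congr 1; rw [hs]; field_simp
    simp_rw [e1, e2] at h1
    rw [← wMeasure_apply _ hE] at h1
    have h3 := ENNReal.rpow_le_rpow h1 hpp.le
    rw [ENNReal.mul_rpow_of_nonneg _ _ hpp.le, ← ENNReal.rpow_mul, ← ENNReal.rpow_mul,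
      one_div_mul_cancel hpp.ne', ENNReal.rpow_one] at h3
    have e3 : 1 / (p / (p - 1)) * p = p - 1 := by field_simp
    rw [e3] at h3
    refine h3.trans ?_
    gcongr
    exact lintegral_mono_set hEJ
  have hEp0 : volume E ^ p ≠ 0 := by simp [hE0, hEt]
  have hEpt : volume E ^ p ≠ ⊤ := ENNReal.rpow_ne_top_of_nonneg hpp.le hEt
  rw [← ENNReal.mul_le_mul_iff_right hEp0 hEpt]
  calc volume E ^ p * wMeasure n w J ≤ wMeasure n w E * SS ^ (p - 1) * wMeasure n w J := by gcongr
    _ = wMeasure n w E * (wMeasure n w J * SS ^ (p - 1)) := by ring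
    _ ≤ wMeasure n w E * (ENNReal.ofReal (ApNorm n p w) * volume J ^ p) := by gcongr
    _ ≤ wMeasure n w E * (ENNReal.ofReal (ApNorm n p w) * (2 * volume E) ^ p) := by gcongr
    _ = _ := by
      rw [ENNReal.mul_rpow_of_nonneg _ _ hpp.le, ENNReal.ofReal_mul (by positivity),
        ← ENNReal.ofReal_rpow_of_pos two_pos, ENNReal.ofReal_ofNat]
      ring

/-- Half-open dyadic cubes of generation `k` of the cube with corner `a` and side `h`. -/
def dcube {n : ℕ} (a : Fin n → ℝ) (h : ℝ) (k : ℕ) (m : Fin n → ℤ) : Set (Fin n → ℝ) :=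
  {x | ∀ i, a i + h / 2 ^ k * m i ≤ x i ∧ x i < a i + h / 2 ^ k * (m i + 1)}

/-- The triple of a dyadic cube. -/
def tcube {n : ℕ} (a : Fin n → ℝ) (h : ℝ) (k : ℕ) (m : Fin n → ℤ) : Set (Fin n → ℝ) :=
  {x | ∀ i, a i + h / 2 ^ k * (m i - 1) ≤ x i ∧ x i < a i + h / 2 ^ k * (m i + 2)}

/-- Indices of the maximal dyadic cubes whose average exceeds `lam`. -/
def stopped {n : ℕ} (ν : Measure (Fin n → ℝ)) (a : Fin n → ℝ) (h : ℝ) (lam : ℝ≥0∞) :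
    Set (ℕ × (Fin n → ℤ)) :=
  {q | lam * volume (dcube a h q.1 q.2) < ν (dcube a h q.1 q.2) ∧
    ∀ j < q.1, ∀ m' : Fin n → ℤ, (dcube a h q.1 q.2 ∩ dcube a h j m').Nonempty →
      ν (dcube a h j m') ≤ lam * volume (dcube a h j m')}

/-- Union of the stopped cubes. -/
def Dset {n : ℕ} (ν : Measure (Fin n → ℝ)) (a : Fin n → ℝ) (h : ℝ) (lam : ℝ≥0∞) :
    Set (Fin n → ℝ) := ⋃ q ∈ stopped ν a h lam, dcube a h q.1 q.2

/-- Union of the triples of the stopped cubes. -/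
def Oset {n : ℕ} (ν : Measure (Fin n → ℝ)) (a : Fin n → ℝ) (h : ℝ) (lam : ℝ≥0∞) :
    Set (Fin n → ℝ) := ⋃ q ∈ stopped ν a h lam, tcube a h q.1 q.2

section dyadic

variable {n : ℕ} {a : Fin n → ℝ} {h : ℝ}

lemma dcube_eq_pi (k : ℕ) (m : Fin n → ℤ) : dcube a h k m =
    Set.pi Set.univ (fun i => Set.Ico (a i + h / 2 ^ k * m i) (a i + h / 2 ^ k * (m i + 1))) := by
  ext x; simp [dcube]

lemma tcube_eq_pi (k : ℕ) (m : Fin n → ℤ) : tcube a h k m =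
    Set.pi Set.univ
      (fun i => Set.Ico (a i + h / 2 ^ k * (m i - 1)) (a i + h / 2 ^ k * (m i + 2))) := by
  ext x; simp [tcube]

lemma measurableSet_dcube (k : ℕ) (m : Fin n → ℤ) : MeasurableSet (dcube a h k m) := by
  rw [dcube_eq_pi]; exact MeasurableSet.univ_pi (fun i => measurableSet_Ico)

lemma measurableSet_tcube (k : ℕ) (m : Fin n → ℤ) : MeasurableSet (tcube a h k m) := by
  rw [tcube_eq_pi]; exact MeasurableSet.univ_pi (fun i => measurableSet_Ico)

lemma volume_dcube (k : ℕ) (m : Fin n → ℤ) :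
    volume (dcube a h k m) = ENNReal.ofReal (h / 2 ^ k) ^ n := by
  rw [dcube_eq_pi, volume_pi_pi]
  have : ∀ i, volume (Set.Ico (a i + h / 2 ^ k * m i) (a i + h / 2 ^ k * (m i + 1)))
      = ENNReal.ofReal (h / 2 ^ k) := fun i => by
    rw [Real.volume_Ico]; congr 1; ring
  simp [this]

lemma volume_tcube (k : ℕ) (m : Fin n → ℤ) :
    volume (tcube a h k m) = 3 ^ n * volume (dcube a h k m) := by
  rw [tcube_eq_pi, volume_pi_pi, volume_dcube]
  have : ∀ i, volume (Set.Ico (a i + h / 2 ^ k * (m i - 1)) (a i + h / 2 ^ k * (m i + 2)))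
      = 3 * ENNReal.ofReal (h / 2 ^ k) := fun i => by
    rw [Real.volume_Ico, ← ENNReal.ofReal_ofNat, ← ENNReal.ofReal_mul (by norm_num)]
    congr 1; ring
  simp [this, mul_pow]

lemma volume_dcube_ne_top (k : ℕ) (m : Fin n → ℤ) : volume (dcube a h k m) ≠ ⊤ := by
  rw [volume_dcube]; simp

lemma dcube_ae_eq (k : ℕ) (m : Fin n → ℤ) :
    dcube a h k m =ᵐ[volume] cube (fun i => a i + h / 2 ^ k * m i) (h / 2 ^ k) := by
  rw [dcube_eq_pi, cube_eq_pi]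
  have e : (fun i => Set.Ico (a i + h / 2 ^ k * m i) (a i + h / 2 ^ k * (m i + 1))) =
    fun i => Set.Ico (a i + h / 2 ^ k * m i) (a i + h / 2 ^ k * m i + h / 2 ^ k) := by
    ext1 i; congr 1; ring
  rw [e]
  exact (Measure.univ_pi_Ico_ae_eq_Icc (μ := fun _ : Fin n => (volume : Measure ℝ))).trans
    (Measure.univ_pi_Ioo_ae_eq_Icc (μ := fun _ : Fin n => (volume : Measure ℝ))).symm

lemma exists_mem_dcube (hh : 0 < h) (k : ℕ) (x : Fin n → ℝ) : ∃ m, x ∈ dcube a h k m := by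
  have hs : 0 < h / 2 ^ k := by positivity
  refine ⟨fun i => ⌊(x i - a i) / (h / 2 ^ k)⌋, fun i => ⟨?_, ?_⟩⟩
  · have := Int.floor_le ((x i - a i) / (h / 2 ^ k))
    rw [le_div_iff₀ hs] at this
    linarith
  · have := Int.lt_floor_add_one ((x i - a i) / (h / 2 ^ k))
    rw [div_lt_iff₀ hs] at this
    linarith

lemma dcube_nested (hh : 0 < h) {j k : ℕ} (hjk : j ≤ k) {m m' : Fin n → ℤ}
    (hne : (dcube a h k m ∩ dcube a h j m').Nonempty) : dcube a h k m ⊆ dcube a h j m' := by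
  obtain ⟨z, hz, hz'⟩ := hne
  intro y hy i
  obtain ⟨d, rfl⟩ := Nat.exists_eq_add_of_le hjk
  have hs : 0 < h / 2 ^ (j + d) := by positivity
  have hsj : h / 2 ^ j = h / 2 ^ (j + d) * 2 ^ d := by rw [pow_add]; field_simp
  have h1 := hz i
  have h2 := hz' i
  have h3 := hy i
  rw [hsj] at h2 ⊢
  set s := h / 2 ^ (j + d)
  have i1 : (2 : ℤ) ^ d * m' i < m i + 1 := by
    have : s * ((2 : ℝ) ^ d * m' i) < s * (m i + 1) := by nlinarith
    exact_mod_cast lt_of_mul_lt_mul_left this hs.le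
  have i2 : m i < (2 : ℤ) ^ d * (m' i + 1) := by
    have : s * (m i) < s * ((2 : ℝ) ^ d * (m' i + 1)) := by nlinarith
    exact_mod_cast lt_of_mul_lt_mul_left this hs.le
  have j1 : (2 : ℝ) ^ d * m' i ≤ m i := by exact_mod_cast Int.lt_add_one_iff.mp i1
  have j2 : (m i : ℝ) + 1 ≤ 2 ^ d * (m' i + 1) := by exact_mod_cast Int.add_one_le_iff.mpr i2
  have k1 := mul_le_mul_of_nonneg_left j1 hs.le
  have k2 := mul_le_mul_of_nonneg_left j2 hs.le
  constructor <;> linarith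

lemma dcube_index_eq (hh : 0 < h) {k : ℕ} {m m' : Fin n → ℤ}
    (hne : (dcube a h k m ∩ dcube a h k m').Nonempty) : m = m' := by
  obtain ⟨z, hz, hz'⟩ := hne
  ext i
  have hs : 0 < h / 2 ^ k := by positivity
  have h1 := hz i
  have h2 := hz' i
  have i1 : m' i < m i + 1 := by
    have : h / 2 ^ k * (m' i) < h / 2 ^ k * (m i + 1) := by linarith
    exact_mod_cast lt_of_mul_lt_mul_left this hs.le
  have i2 : m i < m' i + 1 := by
    have : h / 2 ^ k * (m i) < h / 2 ^ k * (m' i + 1) := by linarith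
    exact_mod_cast lt_of_mul_lt_mul_left this hs.le
  omega

variable {ν : Measure (Fin n → ℝ)} {lam lam' : ℝ≥0∞}

lemma exists_stopped (hh : 0 < h) {k : ℕ} {m : Fin n → ℤ}
    (hbad : lam * volume (dcube a h k m) < ν (dcube a h k m)) :
    ∃ q ∈ stopped ν a h lam, q.1 ≤ k ∧ dcube a h k m ⊆ dcube a h q.1 q.2 := by
  classical
  have hne : (dcube a h k m).Nonempty := by
    rw [Set.nonempty_iff_ne_empty]; intro h0; rw [h0] at hbad; simp at hbad
  have hex : ∃ j, j ≤ k ∧ ∃ m', (dcube a h k m ∩ dcube a h j m').Nonempty ∧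
      lam * volume (dcube a h j m') < ν (dcube a h j m') :=
    ⟨k, le_rfl, m, by simpa using hne, hbad⟩
  obtain ⟨hj, m', hn, hb⟩ := Nat.find_spec hex
  refine ⟨(Nat.find hex, m'), ⟨hb, ?_⟩, hj, dcube_nested hh hj hn⟩
  intro i hi m'' hn'
  by_contra hc
  refine Nat.find_min hex hi ⟨hi.le.trans hj, m'', ?_, not_le.mp hc⟩
  have h1 := dcube_nested hh hj hn
  have h2 := dcube_nested hh hi.le hn'
  obtain ⟨z, hz⟩ := hne
  exact ⟨z, hz, h2 (h1 hz)⟩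

lemma stopped_sub (hh : 0 < h) (hl : lam ≤ lam') {q q' : ℕ × (Fin n → ℤ)}
    (hq : q ∈ stopped ν a h lam) (hq' : q' ∈ stopped ν a h lam')
    (hne : (dcube a h q'.1 q'.2 ∩ dcube a h q.1 q.2).Nonempty) :
    q.1 ≤ q'.1 ∧ dcube a h q'.1 q'.2 ⊆ dcube a h q.1 q.2 := by
  have hle : q.1 ≤ q'.1 := by
    by_contra hc
    have h1 := hq.2 q'.1 (not_le.mp hc) q'.2 (by rwa [Set.inter_comm])
    have h2 := hq'.1
    have : lam * volume (dcube a h q'.1 q'.2) ≤ lam' * volume (dcube a h q'.1 q'.2) := by gcongr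
    exact absurd (h1.trans this) (not_le.mpr h2)
  exact ⟨hle, dcube_nested hh hle hne⟩

lemma stopped_disjoint (hh : 0 < h) :
    (stopped ν a h lam).PairwiseDisjoint (fun q => dcube a h q.1 q.2) := by
  intro q hq q' hq' hne
  rw [Function.onFun, Set.disjoint_iff_inter_eq_empty]
  by_contra hc
  rw [← ne_eq, ← Set.nonempty_iff_ne_empty] at hc
  have hc' : (dcube a h q'.1 q'.2 ∩ dcube a h q.1 q.2).Nonempty := by rwa [Set.inter_comm]
  have h1 := (stopped_sub hh le_rfl hq hq' hc').1
  have h2 := (stopped_sub hh le_rfl hq' hq hc).1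
  obtain ⟨k, m⟩ := q
  obtain ⟨k', m'⟩ := q'
  obtain rfl : k = k' := le_antisymm h1 h2
  obtain rfl : m = m' := dcube_index_eq hh hc
  exact hne rfl

lemma stopped_countable : (stopped ν a h lam).Countable := Set.to_countable _

lemma measurableSet_Dset : MeasurableSet (Dset ν a h lam) :=
  MeasurableSet.biUnion stopped_countable fun _ _ => measurableSet_dcube _ _

lemma measurableSet_Oset : MeasurableSet (Oset ν a h lam) :=
  MeasurableSet.biUnion stopped_countable fun _ _ => measurableSet_tcube _ _

lemma Dset_anti (hh : 0 < h) (hl : lam ≤ lam') : Dset ν a h lam' ⊆ Dset ν a h lam := by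
  refine Set.iUnion₂_subset fun q hq => ?_
  obtain ⟨q', hq', -, hsub⟩ := exists_stopped (lam := lam) hh
    (lt_of_le_of_lt (by gcongr) hq.1)
  exact hsub.trans (Set.subset_biUnion_of_mem (u := fun q => dcube a h q.1 q.2) hq')

lemma measure_Dset_inter (hh : 0 < h) (ρ : Measure (Fin n → ℝ)) {B : Set (Fin n → ℝ)}
    (hB : MeasurableSet B) :
    ρ (Dset ν a h lam ∩ B) = ∑' q : stopped ν a h lam, ρ (dcube a h q.1.1 q.1.2 ∩ B) := by
  rw [Dset, Set.iUnion₂_inter, measure_biUnion stopped_countable]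
  · exact (stopped_disjoint hh).mono_on fun q _ => Set.inter_subset_left
  · exact fun q _ => (measurableSet_dcube _ _).inter hB

lemma stopped_weak (hh : 0 < h) (hl : lam ≤ lam') {q : ℕ × (Fin n → ℤ)}
    (hq : q ∈ stopped ν a h lam) :
    lam' * volume (Dset ν a h lam' ∩ dcube a h q.1 q.2) ≤ ν (dcube a h q.1 q.2) := by
  rw [measure_Dset_inter hh _ (measurableSet_dcube _ _), ← ENNReal.tsum_mul_left]
  calc _ ≤ ∑' q' : stopped ν a h lam', ν (dcube a h q'.1.1 q'.1.2 ∩ dcube a h q.1 q.2) := by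
        refine ENNReal.tsum_le_tsum fun q' => ?_
        rcases Set.eq_empty_or_nonempty (dcube a h q'.1.1 q'.1.2 ∩ dcube a h q.1 q.2) with he | he
        · simp [he]
        · rw [Set.inter_eq_left.mpr (stopped_sub hh hl hq q'.2 he).2]
          exact q'.2.1.le
    _ = ν (Dset ν a h lam' ∩ dcube a h q.1 q.2) :=
        (measure_Dset_inter hh _ (measurableSet_dcube _ _)).symm
    _ ≤ _ := measure_mono Set.inter_subset_right

lemma stopped_parent (hh : 0 < h) (hl : ν Set.univ ≤ lam * ENNReal.ofReal h ^ n)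
    {q : ℕ × (Fin n → ℤ)} (hq : q ∈ stopped ν a h lam) :
    ν (dcube a h q.1 q.2) ≤ 2 ^ n * lam * volume (dcube a h q.1 q.2) := by
  obtain ⟨k, m⟩ := q
  have hne : (dcube a h k m).Nonempty := by
    rw [Set.nonempty_iff_ne_empty]; intro h0; have := hq.1; simp [h0] at this
  rcases k with _ | k
  · exfalso
    have := hq.1
    rw [volume_dcube] at this
    simp only [pow_zero, div_one] at this
    exact absurd ((measure_mono (Set.subset_univ _)).trans hl) (not_le.mpr this)
  · obtain ⟨z, hz⟩ := hne
    obtain ⟨m', hm'⟩ := exists_mem_dcube (a := a) hh k z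
    have hn : (dcube a h (k + 1) m ∩ dcube a h k m').Nonempty := ⟨z, hz, hm'⟩
    have h1 := hq.2 k (Nat.lt_succ_self k) m' hn
    have h2 := dcube_nested hh (Nat.le_succ k) hn
    refine (measure_mono h2).trans (h1.trans (le_of_eq ?_))
    rw [volume_dcube, volume_dcube]
    have : h / 2 ^ k = 2 * (h / 2 ^ (k + 1)) := by rw [pow_succ]; field_simp
    rw [this, ENNReal.ofReal_mul (by norm_num), mul_pow, ENNReal.ofReal_ofNat]
    ring

lemma stopped_half (hh : 0 < h) (hl : ν Set.univ ≤ lam * ENNReal.ofReal h ^ n)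
    (hl0 : lam ≠ 0) (hlt : lam ≠ ⊤)
    {q : ℕ × (Fin n → ℤ)} (hq : q ∈ stopped ν a h lam) :
    volume (dcube a h q.1 q.2) ≤
      2 * volume (dcube a h q.1 q.2 \ Dset ν a h (2 ^ (n + 1) * lam)) := by
  set J := dcube a h q.1 q.2 with hJ
  set D := Dset ν a h (2 ^ (n + 1) * lam) with hD
  have hll : lam ≤ 2 ^ (n + 1) * lam := by
    have : (1 : ℝ≥0∞) ≤ 2 ^ (n + 1) := one_le_pow₀ (by norm_num)
    calc lam = 1 * lam := (one_mul _).symm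
      _ ≤ _ := by gcongr
  have h1 := (stopped_weak hh hll hq).trans (stopped_parent hh hl hq)
  have hc0 : (2 : ℝ≥0∞) ^ n * lam ≠ 0 := mul_ne_zero (by simp) hl0
  have hct : (2 : ℝ≥0∞) ^ n * lam ≠ ⊤ := ENNReal.mul_ne_top (by simp) hlt
  have h2 : 2 * volume (D ∩ J) ≤ volume J := by
    rw [← ENNReal.mul_le_mul_iff_right hc0 hct]
    refine le_trans (le_of_eq ?_) h1
    rw [← hD, ← hJ, pow_succ]; ring
  have h3 : volume (J ∩ D) + volume (J \ D) = volume J :=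
    measure_inter_add_sdiff J measurableSet_Dset
  have hvt : volume J ≠ ⊤ := volume_dcube_ne_top _ _
  have h4 : volume J + volume J ≤ volume J + 2 * volume (J \ D) := by
    calc volume J + volume J = 2 * volume (D ∩ J) + 2 * volume (J \ D) := by
          rw [← two_mul, ← h3, Set.inter_comm]; ring
      _ ≤ _ := by gcongr
  exact (ENNReal.add_le_add_iff_left hvt).mp h4

lemma Dset_sum (hh : 0 < h) {lam0 : ℝ≥0∞} (hl : ν Set.univ ≤ lam0 * ENNReal.ofReal h ^ n)
    (hl0 : lam0 ≠ 0) (hlt : lam0 ≠ ⊤) {T : ℝ≥0∞}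
    (hT : ∀ k m, ∀ E ⊆ dcube a h k m, MeasurableSet E → volume (dcube a h k m) ≤ 2 * volume E →
      ν (dcube a h k m) ≤ T * ν E) :
    ∑' k : ℕ, ν (Dset ν a h ((2 ^ (n + 1)) ^ k * lam0)) ≤ T * ν Set.univ := by
  set D : ℕ → Set (Fin n → ℝ) := fun k => Dset ν a h ((2 ^ (n + 1)) ^ k * lam0) with hD
  have hone : (1 : ℝ≥0∞) ≤ 2 ^ (n + 1) := one_le_pow₀ (by norm_num)
  have hDm : ∀ k, MeasurableSet (D k) := fun k => measurableSet_Dset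
  have hanti : Antitone D := fun i j hij => Dset_anti hh (by gcongr)
  have hstep : ∀ k, ν (D k) ≤ T * ν (D k \ D (k + 1)) := by
    intro k
    have e1 := measure_Dset_inter (ν := ν) (a := a) (lam := (2 ^ (n + 1)) ^ k * lam0) hh ν
      MeasurableSet.univ
    have e2 := measure_Dset_inter (ν := ν) (a := a) (lam := (2 ^ (n + 1)) ^ k * lam0) hh ν
      (hDm (k + 1)).compl
    simp only [Set.inter_univ] at e1
    rw [Set.sdiff_eq]
    simp only [hD] at e2 ⊢
    rw [e1, e2, ← ENNReal.tsum_mul_left]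
    refine ENNReal.tsum_le_tsum fun q => ?_
    rw [← Set.sdiff_eq]
    refine hT _ _ _ Set.sdiff_subset ((measurableSet_dcube _ _).diff measurableSet_Dset) ?_
    have e3 : ((2 : ℝ≥0∞) ^ (n + 1)) ^ (k + 1) * lam0
        = 2 ^ (n + 1) * ((2 ^ (n + 1)) ^ k * lam0) := by rw [pow_succ]; ring
    rw [e3]
    refine stopped_half hh (hl.trans ?_) (mul_ne_zero (by simp) hl0)
      (ENNReal.mul_ne_top (by simp) hlt) q.2
    gcongr
    calc lam0 = 1 * lam0 := (one_mul _).symm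
      _ ≤ _ := by gcongr; exact one_le_pow₀ hone
  calc ∑' k, ν (D k) ≤ ∑' k, T * ν (D k \ D (k + 1)) := ENNReal.tsum_le_tsum hstep
    _ = T * ∑' k, ν (D k \ D (k + 1)) := ENNReal.tsum_mul_left
    _ = T * ν (⋃ k, D k \ D (k + 1)) := by
        rw [measure_iUnion _ fun k => (hDm k).diff (hDm (k + 1))]
        have key : ∀ i j, i < j → Disjoint (D i \ D (i + 1)) (D j \ D (j + 1)) := by
          intro i j hij
          rw [Set.disjoint_left]
          rintro x ⟨-, h1⟩ ⟨h2, -⟩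
          exact h1 (hanti hij h2)
        intro i j hij
        rcases lt_or_gt_of_ne hij with h1 | h1
        · exact key i j h1
        · exact (key j i h1).symm
    _ ≤ _ := by gcongr; exact Set.subset_univ _

lemma lam_volume_Oset (hh : 0 < h) :
    lam * volume (Oset ν a h lam) ≤ 3 ^ n * ν (Dset ν a h lam) := by
  have e1 := measure_Dset_inter (ν := ν) (a := a) (lam := lam) hh ν MeasurableSet.univ
  simp only [Set.inter_univ] at e1
  rw [e1, ← ENNReal.tsum_mul_left]
  calc lam * volume (Oset ν a h lam)
      ≤ lam * ∑' q : stopped ν a h lam, volume (tcube a h q.1.1 q.1.2) := by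
        gcongr
        exact measure_biUnion_le volume stopped_countable _
    _ = ∑' q : stopped ν a h lam, lam * volume (tcube a h q.1.1 q.1.2) :=
        ENNReal.tsum_mul_left.symm
    _ ≤ _ := by
        refine ENNReal.tsum_le_tsum fun q => ?_
        rw [volume_tcube]
        calc lam * (3 ^ n * volume (dcube a h q.1.1 q.1.2))
            = 3 ^ n * (lam * volume (dcube a h q.1.1 q.1.2)) := by ring
          _ ≤ _ := by gcongr; exact q.2.1.le

lemma off_Oset (hh : 0 < h) (hl : ν Set.univ ≤ lam * ENNReal.ofReal h ^ n)
    {x : Fin n → ℝ} (hx : x ∉ Oset ν a h lam) {b : Fin n → ℝ} {r : ℝ} (hr : 0 < r)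
    (hxb : x ∈ cube b r) : ν (cube b r) ≤ 6 ^ n * lam * volume (cube b r) := by
  rw [volume_cube]
  rcases le_or_gt h r with hhr | hrh
  · refine (measure_mono (Set.subset_univ _)).trans (hl.trans ?_)
    have : (1 : ℝ≥0∞) ≤ 6 ^ n := one_le_pow₀ (by norm_num)
    calc lam * ENNReal.ofReal h ^ n = 1 * lam * ENNReal.ofReal h ^ n := by rw [one_mul]
      _ ≤ _ := by gcongr
  · obtain ⟨k, hk1, hk2⟩ := exists_nat_pow_near (x := h / r) (y := 2)
      (by rw [le_div_iff₀ hr]; linarith) (by norm_num)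
    rw [le_div_iff₀ hr] at hk1
    rw [div_lt_iff₀ hr] at hk2
    have hs : 0 < h / 2 ^ k := by positivity
    have hrs : r ≤ h / 2 ^ k := by rw [le_div_iff₀ (by positivity)]; linarith
    have hsr : h / 2 ^ k ≤ 2 * r := by
      rw [div_le_iff₀ (by positivity)]; rw [pow_succ] at hk2; linarith
    obtain ⟨m, hm⟩ := exists_mem_dcube (a := a) hh k x
    set P : Finset (Fin n → ℤ) := Fintype.piFinset fun i => Finset.Icc (m i - 1) (m i + 1)
      with hP
    have hcard : P.card = 3 ^ n := by
      rw [hP, Fintype.card_piFinset]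
      have : ∀ i, (Finset.Icc (m i - 1) (m i + 1)).card = 3 := fun i => by
        rw [Int.card_Icc]; omega
      simp [this]
    have hcov : cube b r ⊆ ⋃ m' ∈ P, (dcube a h k m' ∩ cube b r) := by
      intro y hy
      obtain ⟨m', hm'⟩ := exists_mem_dcube (a := a) hh k y
      refine Set.mem_biUnion (x := m') ?_ ⟨hm', hy⟩
      rw [hP, Finset.mem_coe, Fintype.mem_piFinset]
      intro i
      have h1 := hm i
      have h2 := hm' i
      have h3 := hxb i
      have h4 := hy i
      simp only [Set.mem_Ioo] at h3 h4
      have i1 : m' i < m i + 2 := by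
        have : h / 2 ^ k * (m' i) < h / 2 ^ k * (m i + 2) := by linarith
        exact_mod_cast lt_of_mul_lt_mul_left this hs.le
      have i2 : m i < m' i + 2 := by
        have : h / 2 ^ k * (m i) < h / 2 ^ k * (m' i + 2) := by linarith
        exact_mod_cast lt_of_mul_lt_mul_left this hs.le
      rw [Finset.mem_Icc]; omega
    have hone : ∀ m' ∈ P, ν (dcube a h k m' ∩ cube b r) ≤ lam * (2 ^ n * ENNReal.ofReal r ^ n) := by
      intro m' _
      rcases Set.eq_empty_or_nonempty (dcube a h k m' ∩ cube b r) with he | ⟨y, hy, hyb⟩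
      · simp [he]
      · by_cases hbad : lam * volume (dcube a h k m') < ν (dcube a h k m')
        · exfalso
          obtain ⟨q, hq, hqk, hsub⟩ := exists_stopped hh hbad
          refine hx (Set.mem_biUnion hq fun i => ?_)
          have h1 := hsub hy i
          have h3 := hxb i
          have h4 := hyb i
          simp only [Set.mem_Ioo] at h3 h4
          have h5 : h / 2 ^ k ≤ h / 2 ^ q.1 := by
            gcongr; norm_num
          constructor <;> linarith
        · refine (measure_mono Set.inter_subset_left).trans ((not_lt.mp hbad).trans ?_)
          rw [volume_dcube, ← mul_pow]
          gcongr
          rw [← ENNReal.ofReal_ofNat 2, ← ENNReal.ofReal_mul (by norm_num)]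
          exact ENNReal.ofReal_le_ofReal hsr
    calc ν (cube b r) ≤ ν (⋃ m' ∈ P, (dcube a h k m' ∩ cube b r)) := measure_mono hcov
      _ ≤ ∑ m' ∈ P, ν (dcube a h k m' ∩ cube b r) := measure_biUnion_finset_le _ _
      _ ≤ ∑ m' ∈ P, lam * (2 ^ n * ENNReal.ofReal r ^ n) := Finset.sum_le_sum hone
      _ = 6 ^ n * lam * ENNReal.ofReal r ^ n := by
        rw [Finset.sum_const, hcard, nsmul_eq_mul]
        have : (6 : ℝ≥0∞) = 3 * 2 := by norm_num
        rw [this, mul_pow]; push_cast; ring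

end dyadic

lemma maxOp_nonneg {n : ℕ} (f : (Fin n → ℝ) → ℝ) (x : Fin n → ℝ) : 0 ≤ maxOp n f x := by
  refine Real.sSup_nonneg ?_
  rintro _ ⟨a, h, hh, -, rfl⟩
  have h1 : 0 ≤ ∫ y in cube a h, |f y| := integral_nonneg fun y => abs_nonneg _
  positivity

lemma lintegral_maxOp_le {n : ℕ} {w : (Fin n → ℝ) → ℝ}
    (h0 : ∀ x, 0 ≤ w x) (hm : Measurable w) (hw : LocallyIntegrable w volume)
    {a : Fin n → ℝ} {h : ℝ} (hh : 0 < h) (T : ℝ≥0∞)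
    (hkey : ∀ (b : Fin n → ℝ) (r : ℝ), 0 < r → wMeasure n w (cube b r) ≠ 0 →
      ∀ E : Set (Fin n → ℝ), MeasurableSet E → E ⊆ cube b r →
      volume (cube b r) ≤ 2 * volume E → wMeasure n w (cube b r) ≤ T * wMeasure n w E)
    (hM : wMeasure n w (cube a h) ≠ 0) :
    ∫⁻ x in cube a h, ENNReal.ofReal (maxOp n ((cube a h).indicator w) x) ≤
      6 ^ n * (1 + 2 ^ (n + 1) * 3 ^ n) * T * wMeasure n w (cube a h) := by
  set μ := wMeasure n w with hμ
  have hac : μ ≪ volume := withDensity_absolutelyContinuous _ _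
  set Q := cube a h with hQ
  have hQm : MeasurableSet Q := measurableSet_cube a h
  have hQae : dcube a h 0 0 =ᵐ[volume] Q := by
    have := dcube_ae_eq (a := a) (h := h) 0 0
    simpa using this
  have hQae' : dcube a h 0 0 =ᵐ[μ] Q := hac.ae_le hQae
  have hMt : μ Q ≠ ⊤ := wMeasure_cube_ne_top hw a h
  set ν := μ.restrict (dcube a h 0 0) with hν
  have hνQ : ν = μ.restrict Q := Measure.restrict_congr_set hQae'
  have hνu : ν Set.univ = μ Q := by rw [hνQ, Measure.restrict_apply_univ]
  have hT : ∀ k m, ∀ E ⊆ dcube a h k m, MeasurableSet E →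
      volume (dcube a h k m) ≤ 2 * volume E → ν (dcube a h k m) ≤ T * ν E := by
    intro k m E hE hEm hvol
    by_cases hz : ν (dcube a h k m) = 0
    · rw [hz]; exact zero_le
    have hne : (dcube a h k m ∩ dcube a h 0 0).Nonempty := by
      rw [Set.nonempty_iff_ne_empty]; intro he
      rw [hν, Measure.restrict_apply (measurableSet_dcube _ _), he, measure_empty] at hz
      exact hz rfl
    have hsub := dcube_nested hh (Nat.zero_le k) hne
    have e1 : ν (dcube a h k m) = μ (dcube a h k m) := by
      rw [hν, Measure.restrict_apply (measurableSet_dcube _ _), Set.inter_eq_left.mpr hsub]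
    have e2 : ν E = μ E := by
      rw [hν, Measure.restrict_apply hEm, Set.inter_eq_left.mpr (hE.trans hsub)]
    rw [e1, e2]
    rw [e1] at hz
    set R := cube (fun i => a i + h / 2 ^ k * m i) (h / 2 ^ k) with hR
    have hae : dcube a h k m =ᵐ[volume] R := dcube_ae_eq k m
    have hE' : (E ∩ R : Set (Fin n → ℝ)) =ᵐ[volume] E := by
      have h1 : (E ∩ R : Set (Fin n → ℝ)) =ᵐ[volume] (E ∩ dcube a h k m : Set (Fin n → ℝ)) :=
        (Filter.EventuallyEq.refl _ _).inter hae.symm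
      rwa [Set.inter_eq_left.mpr hE] at h1
    have e3 : μ (dcube a h k m) = μ R := measure_congr (hac.ae_le hae)
    rw [e3] at hz ⊢
    refine (hkey _ _ (by positivity) hz (E ∩ R) (hEm.inter (measurableSet_cube _ _))
      Set.inter_subset_right ?_).trans ?_
    · rw [measure_congr hE', ← hR, ← measure_congr hae]; exact hvol
    · gcongr; exact Set.inter_subset_left
  have hV0 : ENNReal.ofReal h ^ n ≠ 0 := by simp [hh]
  have hVt : ENNReal.ofReal h ^ n ≠ ⊤ := by simp
  set lam0 : ℝ≥0∞ := μ Q / ENNReal.ofReal h ^ n with hlam0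
  have hlamV : lam0 * ENNReal.ofReal h ^ n = μ Q := ENNReal.div_mul_cancel hV0 hVt
  have hl0 : lam0 ≠ 0 := by
    intro hc; rw [hc, zero_mul] at hlamV; exact hM hlamV.symm
  have hlt : lam0 ≠ ⊤ := ENNReal.div_ne_top hMt hV0
  set A : ℝ≥0∞ := 2 ^ (n + 1) with hA
  have hA1 : 1 ≤ A := one_le_pow₀ (by norm_num)
  have hAt : A ≠ ⊤ := by simp [hA]
  have hlk : ∀ k : ℕ, lam0 ≤ A ^ k * lam0 := fun k => by
    calc lam0 = 1 * lam0 := (one_mul _).symm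
      _ ≤ _ := by gcongr; exact one_le_pow₀ hA1
  have hsum := Dset_sum (a := a) hh (ν := ν) (lam0 := lam0) (by rw [hνu, hlamV]) hl0 hlt hT
  rw [hνu, ← hA] at hsum
  set O : ℕ → Set (Fin n → ℝ) := fun k => Oset ν a h (A ^ k * lam0) with hO
  have hOm : ∀ k, MeasurableSet (O k) := fun k => measurableSet_Oset
  -- pointwise bound off the exceptional set
  have hoff : ∀ k, ∀ x ∉ O k,
      ENNReal.ofReal (maxOp n (Q.indicator w) x) ≤ 6 ^ n * (A ^ k * lam0) := by
    intro k x hx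
    have hfin : 6 ^ n * (A ^ k * lam0) ≠ ⊤ :=
      ENNReal.mul_ne_top (by simp) (ENNReal.mul_ne_top (ENNReal.pow_ne_top hAt) hlt)
    rw [← ENNReal.ofReal_toReal hfin]
    apply ENNReal.ofReal_le_ofReal
    refine Real.sSup_le ?_ ENNReal.toReal_nonneg
    rintro _ ⟨b, r, hr, hxb, rfl⟩
    have h1 := off_Oset (ν := ν) hh (by rw [hνu, ← hlamV]; gcongr; exact hlk k) hx hr hxb
    have hv0 := volume_cube_ne_zero b hr
    have hvt := volume_cube_ne_top b r
    have h2 : ∫ y in cube b r, |Q.indicator w y| = (ν (cube b r)).toReal := by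
      have : ∀ y, |Q.indicator w y| = Q.indicator w y := fun y =>
        abs_of_nonneg (Set.indicator_nonneg (fun z _ => h0 z) y)
      simp_rw [this]
      rw [setIntegral_indicator hQm, hνQ,
        Measure.restrict_apply (measurableSet_cube b r), hμ,
        wMeasure_apply _ ((measurableSet_cube b r).inter hQm), integral_eq_lintegral_of_nonneg_ae]
      · exact Filter.Eventually.of_forall h0
      · exact hm.aestronglyMeasurable
    rw [h2, inv_mul_le_iff₀ (ENNReal.toReal_pos hv0 hvt), ← ENNReal.toReal_mul]
    apply ENNReal.toReal_mono (ENNReal.mul_ne_top hvt hfin)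
    rw [mul_comm]; exact h1
  have hpt : ∀ x, ENNReal.ofReal (maxOp n (Q.indicator w) x) ≤
      6 ^ n * (lam0 + ∑' k, (O k).indicator (fun _ => A * (A ^ k * lam0)) x) := by
    intro x
    by_cases hex : ∃ k, x ∉ O k
    · classical
      have hk := Nat.find_spec hex
      have hmin := fun i (hi : i < Nat.find hex) => Nat.find_min hex hi
      generalize Nat.find hex = k at hk hmin
      refine (hoff k x hk).trans ?_
      gcongr
      rcases k with _ | k
      · simp
      · have hin : x ∈ O k := not_not.mp (hmin k (Nat.lt_succ_self k))
        refine le_trans ?_ (le_add_left (ENNReal.le_tsum k))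
        rw [Set.indicator_of_mem hin, pow_succ]
        exact le_of_eq (by ring)
    · push Not at hex
      have htop : ∑' k, (O k).indicator (fun _ => A * (A ^ k * lam0)) x = ⊤ := by
        rw [eq_top_iff, ← ENNReal.tsum_const_eq_top_of_ne_zero (α := ℕ) hl0]
        refine ENNReal.tsum_le_tsum fun k => ?_
        rw [Set.indicator_of_mem (hex k)]
        calc lam0 = 1 * lam0 := (one_mul _).symm
          _ ≤ _ := mul_le_mul' hA1 (hlk k)
      rw [htop, add_top, ENNReal.mul_top (by simp)]
      exact le_top
  have hMT : μ Q ≤ T * μ Q := by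
    refine hkey a h hh hM Q hQm le_rfl ?_
    rw [two_mul]; exact le_self_add
  calc ∫⁻ x in Q, ENNReal.ofReal (maxOp n (Q.indicator w) x)
      ≤ ∫⁻ x in Q, 6 ^ n * (lam0 + ∑' k, (O k).indicator (fun _ => A * (A ^ k * lam0)) x) :=
        lintegral_mono hpt
    _ = 6 ^ n * (lam0 * volume Q + ∑' k, ∫⁻ x in Q, (O k).indicator
          (fun _ => A * (A ^ k * lam0)) x) := by
        rw [lintegral_const_mul' _ _ (by simp), lintegral_add_left measurable_const,
          setLIntegral_const, lintegral_tsum fun k =>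
            (measurable_const.indicator (hOm k)).aemeasurable]
    _ ≤ 6 ^ n * (μ Q + ∑' k, A * (3 ^ n * ν (Dset ν a h (A ^ k * lam0)))) := by
        gcongr with k
        · rw [hQ, volume_cube, hlamV]
        · refine (setLIntegral_le_lintegral _ _).trans ?_
          rw [lintegral_indicator_const (hOm k), mul_assoc]
          exact mul_le_mul_right (lam_volume_Oset hh) A
    _ = 6 ^ n * (μ Q + A * (3 ^ n * ∑' k, ν (Dset ν a h (A ^ k * lam0)))) := by
        rw [ENNReal.tsum_mul_left, ENNReal.tsum_mul_left]
    _ ≤ 6 ^ n * (T * μ Q + A * (3 ^ n * (T * μ Q))) := by gcongr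
    _ = _ := by ring

/-- If a weight `w` satisfies Buckley's estimate
`‖Mf‖_{L^p(w)} ≤ c ‖w‖_{A_p}^{1/(p−1)} ‖f‖_{L^p(w)}` for some fixed `p > 1` (with a
constant `c = c(p,n)`), then `‖w‖_{A_∞} ≤ C ‖w‖_{A_p}` for a constant `C = C(p,n,c)`. -/
theorem AinfNorm_le_of_buckley (n : ℕ) (p : ℝ) (hp : 1 < p) (c : ℝ) :
    ∃ C : ℝ, ∀ w : (Fin n → ℝ) → ℝ, (∀ x, 0 ≤ w x) → Measurable w →
      LocallyIntegrable w volume →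
      (∀ f : (Fin n → ℝ) → ℝ, Measurable f →
        eLpNorm (maxOp n f) (ENNReal.ofReal p) (wMeasure n w) ≤
          ENNReal.ofReal (c * ApNorm n p w ^ (1 / (p - 1))) *
            eLpNorm f (ENNReal.ofReal p) (wMeasure n w)) →
      AinfNorm n w ≤ C * ApNorm n p w := by
  refine ⟨6 ^ n * (1 + 2 ^ (n + 1) * 3 ^ n) * 2 ^ p, fun w h0 hm hw hB => ?_⟩
  have hAp : 0 ≤ ApNorm n p w := by
    refine Real.sSup_nonneg ?_
    rintro _ ⟨a, h, hh, rfl⟩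
    have h1 : 0 ≤ ∫ x in cube a h, w x := integral_nonneg h0
    have h2 : 0 ≤ ∫ x in cube a h, w x ^ (-(1 / (p - 1))) :=
      integral_nonneg fun x => Real.rpow_nonneg (h0 x) _
    positivity
  have hp1 : 0 < p - 1 := by linarith
  refine Real.sSup_le ?_ (by positivity)
  rintro _ ⟨a, h, hh, rfl⟩
  rw [integral_cube h0 hm]
  by_cases hM : wMeasure n w (cube a h) = 0
  · rw [hM]; simp; positivity
  have hK := (sigma_finite_of_buckley hp h0 hm _ ENNReal.ofReal_ne_top hB a hh hM).1
  have hbdd : BddAbove (ApSet n p w) := by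
    by_contra hnb
    apply hK
    rw [ApNorm, Real.sSup_of_not_bddAbove hnb, Real.zero_rpow (by positivity), mul_zero,
      ENNReal.ofReal_zero]
  have hσ := fun (b : Fin n → ℝ) (r : ℝ) (hr : 0 < r) hb =>
    (sigma_finite_of_buckley hp h0 hm _ ENNReal.ofReal_ne_top hB b hr hb).2
  have hkey := fun (b : Fin n → ℝ) (r : ℝ) (hr : 0 < r) hb (E : Set (Fin n → ℝ)) =>
    ap_key hp h0 hm hw hbdd b hr (hσ b r hr hb) (E := E)
  have hmain := lintegral_maxOp_le h0 hm hw hh (ENNReal.ofReal (2 ^ p * ApNorm n p w)) hkey hM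
  have hMt := wMeasure_cube_ne_top hw a h
  set M := wMeasure n w (cube a h) with hMdef
  have h1 : ∫ x in cube a h, maxOp n ((cube a h).indicator w) x ≤
      6 ^ n * (1 + 2 ^ (n + 1) * 3 ^ n) * (2 ^ p * ApNorm n p w) * M.toReal := by
    refine (Real.le_norm_self _).trans ((norm_integral_le_lintegral_norm _).trans ?_)
    simp_rw [Real.norm_of_nonneg (maxOp_nonneg _ _)]
    refine (ENNReal.toReal_mono ?_ hmain).trans (le_of_eq ?_)
    · refine ENNReal.mul_ne_top (ENNReal.mul_ne_top (ENNReal.mul_ne_top (by simp) ?_)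
        ENNReal.ofReal_ne_top) hMt
      simp [ENNReal.mul_eq_top]
    · rw [ENNReal.toReal_mul, ENNReal.toReal_mul, ENNReal.toReal_mul,
        ENNReal.toReal_ofReal (by positivity),
        ENNReal.toReal_add (by simp) (by simp [ENNReal.mul_eq_top])]
      simp only [ENNReal.toReal_mul, ENNReal.toReal_pow, ENNReal.toReal_ofNat,
        ENNReal.toReal_one]
  rw [inv_mul_le_iff₀ (ENNReal.toReal_pos hM hMt)]
  refine h1.trans (le_of_eq ?_)
  ring
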